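/- Suppose (s_0s_1)^2 = g_1⋯g_r in G = ℤ/2 * ℤ/3, where each g_i is a conjugate of s_1 = bwb. Then r ≥ 4, and a finite sequence of Hurwitz moves transforms the sequence (g_1,…,g_r) into a sequence (g_1',…,g_r') of conjugates of s_1 with g_1' = s_0, g_2' = s_1, g_3' = s_0, g_4' = s_1, and g_5'⋯g_r' = 1. -/

import Mathlib

/-- `G = ℤ/2 * ℤ/3`, the free product of cyclic groups of orders 2 and 3
(isomorphic to `PSL(2,ℤ)`). -/
abbrev G23 := Monoid.Coprod (Multiplicative (ZMod 2)) (Multiplicative (ZMod 3))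

/-- The generator `w` of the `ℤ/2` factor. -/
def w : G23 := Monoid.Coprod.inl (Multiplicative.ofAdd (1 : ZMod 2))

/-- The generator `b` of the `ℤ/3` factor. -/
def b : G23 := Monoid.Coprod.inr (Multiplicative.ofAdd (1 : ZMod 3))

/-- `s₀ = wb²`. -/
def s0 : G23 := w * b ^ 2

/-- `s₁ = bwb`. -/
def s1 : G23 := b * w * b

/-- `s₂ = b²w`. -/
def s2 : G23 := b ^ 2 * w

/-- A single Hurwitz move on a finite sequence of elements of a group: some consecutive
pair `(a, b)` is replaced by `(b, b⁻¹ * a * b)` or by `(a * b * a⁻¹, a)`. -/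
def HurwitzMove {G : Type*} [Group G] (L L' : List G) : Prop :=
  ∃ (p : List G) (x y : G) (t : List G),
    L = p ++ x :: y :: t ∧
    (L' = p ++ y :: (y⁻¹ * x * y) :: t ∨ L' = p ++ (x * y * x⁻¹) :: x :: t)

/-- A finite sequence of Hurwitz moves. -/
def HurwitzEquiv {G : Type*} [Group G] : List G → List G → Prop :=
  Relation.ReflTransGen HurwitzMove

/-! ### Powers of `b` and words in the generators -/

/-- The element `b ^ i`, for an exponent `i` modulo `3`. -/
def bpow (i : ZMod 3) : G23 := Monoid.Coprod.inr (Multiplicative.ofAdd i)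

lemma bpow_add (i j : ZMod 3) : bpow (i + j) = bpow i * bpow j := by
  simp [bpow, ofAdd_add]

lemma bpow_zero : bpow 0 = 1 := by simp [bpow]

lemma bpow_one : bpow 1 = b := rfl

lemma bpow_two : bpow 2 = b ^ 2 := by
  rw [pow_two, ← bpow_one, ← bpow_add]; rfl

lemma bpow_inv (i : ZMod 3) : (bpow i)⁻¹ = bpow (-i) := by
  rw [inv_eq_iff_mul_eq_one, ← bpow_add, add_neg_cancel, bpow_zero]

lemma bpow_mul_bpow_mul (i j : ZMod 3) (x : G23) : bpow i * (bpow j * x) = bpow (i + j) * x := by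
  rw [bpow_add, mul_assoc]

lemma w_mul_w : w * w = 1 := by
  rw [w, ← map_mul, ← ofAdd_add, show (1 : ZMod 2) + 1 = 0 from rfl, ofAdd_zero, map_one]

lemma w_mul_w_mul (x : G23) : w * (w * x) = x := by
  rw [← mul_assoc, w_mul_w, one_mul]

lemma w_inv : w⁻¹ = w := inv_eq_of_mul_eq_one_left w_mul_w

/-- A word `(l, k)` encodes a product of powers of `b` separated by `w`:
the exponents of the powers followed by `w` are listed in `l`, the last exponent is `k`. -/
abbrev BWord := List (ZMod 3) × ZMod 3

/-- The group element encoded by the word `(l, k)`. -/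
def wordEval : List (ZMod 3) → ZMod 3 → G23
  | [], k => bpow k
  | i :: l, k => bpow i * w * wordEval l k

/-- The conjugate of `s₀` by the element encoded by a word. -/
def wordConj (d : BWord) : G23 := wordEval d.1 d.2 * s0 * (wordEval d.1 d.2)⁻¹

/-- Left multiplication of a word by `b ^ i`. -/
def shift (i : ZMod 3) : BWord → BWord
  | ([], k) => ([], i + k)
  | (j :: l, k) => ((i + j) :: l, k)

lemma shift_length (i : ZMod 3) (d : BWord) : (shift i d).1.length = d.1.length := by
  rcases d with ⟨_ | ⟨j, l⟩, k⟩ <;> rfl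

lemma wordEval_shift (i : ZMod 3) (d : BWord) :
    wordEval (shift i d).1 (shift i d).2 = bpow i * wordEval d.1 d.2 := by
  rcases d with ⟨_ | ⟨j, l⟩, k⟩ <;> simp [shift, wordEval, bpow_add, mul_assoc]

lemma wordConj_of_mul_left {d d' : BWord} {h : G23}
    (e : wordEval d'.1 d'.2 = h * wordEval d.1 d.2) :
    wordConj d' = h * wordConj d * h⁻¹ := by
  rw [wordConj, e, wordConj]; group

lemma wordConj_shift (i : ZMod 3) (d : BWord) :
    wordConj (shift i d) = bpow i * wordConj d * (bpow i)⁻¹ :=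
  wordConj_of_mul_left (wordEval_shift i d)

lemma wordConj_cons (i : ZMod 3) (d : BWord) :
    wordConj (i :: d.1, d.2) = (bpow i * w) * wordConj d * (bpow i * w)⁻¹ :=
  wordConj_of_mul_left rfl

lemma wordConj_nil (k : ZMod 3) : wordConj ([], k) = bpow k * w * bpow (2 - k) := by
  simp only [wordConj, wordEval, s0, ← bpow_two, bpow_inv, mul_assoc, ← bpow_add, sub_eq_add_neg]

lemma wordConj_nil_inv (k : ZMod 3) :
    (wordConj ([], k))⁻¹ = bpow (1 + k) * w * bpow (-k) := by
  rw [wordConj_nil]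
  simp only [mul_inv_rev, bpow_inv, w_inv, mul_assoc]
  congr 2
  revert k; decide

lemma wordConj_nil_zero : wordConj ([], 0) = s0 := by
  simp [wordConj, wordEval, bpow_zero]

lemma wordConj_nil_one : wordConj ([], 1) = s1 := by
  rw [wordConj_nil]; rfl

lemma wordConj_nil_mul_succ (k : ZMod 3) : wordConj ([], k) * wordConj ([], k + 1) = b := by
  rw [wordConj_nil, wordConj_nil]
  simp only [mul_assoc, bpow_mul_bpow_mul]
  rw [show 2 - k + (k + 1) = 0 by revert k; decide, bpow_zero, one_mul, w_mul_w_mul, ← bpow_add,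
    ← bpow_one]
  congr 1; revert k; decide

lemma s0_mul_s1 : s0 * s1 = b := by
  rw [← wordConj_nil_zero, ← wordConj_nil_one]; exact wordConj_nil_mul_succ 0

lemma exists_wordEval (c : G23) : ∃ d : BWord, wordEval d.1 d.2 = c := by
  have hw (d : BWord) : ∃ d' : BWord, wordEval d'.1 d'.2 = w * wordEval d.1 d.2 :=
    ⟨(0 :: d.1, d.2), by simp [wordEval, bpow_zero]⟩
  have key (c : G23) : ∀ d : BWord, ∃ d' : BWord, wordEval d'.1 d'.2 = c * wordEval d.1 d.2 := by
    induction c using Monoid.Coprod.induction_on with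
    | inl m =>
      intro d
      have hm : m = Multiplicative.ofAdd 0 ∨ m = Multiplicative.ofAdd 1 := by
        revert m; decide
      rcases hm with rfl | rfl
      · exact ⟨d, by simp⟩
      · exact hw d
    | inr n => exact fun d => ⟨shift n.toAdd d, wordEval_shift _ _⟩
    | mul x y hx hy =>
      intro d
      obtain ⟨d₁, h₁⟩ := hy d
      obtain ⟨d₂, h₂⟩ := hx d₁
      exact ⟨d₂, by rw [h₂, h₁, mul_assoc]⟩
  obtain ⟨d, hd⟩ := key c ([], 0)
  exact ⟨d, by simpa [wordEval, bpow_zero] using hd⟩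

lemma exists_wordConj {g : G23} (hg : IsConj s1 g) : ∃ d, wordConj d = g := by
  obtain ⟨c, rfl⟩ := isConj_iff.1 hg
  obtain ⟨d, hd⟩ := exists_wordEval (c * b)
  refine ⟨d, ?_⟩
  rw [wordConj, hd, ← wordConj_nil_one, wordConj, wordEval, bpow_one]
  group

lemma exists_map_wordConj {L : List G23} (hL : ∀ g ∈ L, IsConj s1 g) :
    ∃ D : List BWord, D.map wordConj = L := by
  induction L with
  | nil => exact ⟨[], rfl⟩
  | cons g L ih =>
    obtain ⟨d, hd⟩ := exists_wordConj (hL g (by simp))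
    obtain ⟨D, hD⟩ := ih fun x hx => hL x (by simp [hx])
    exact ⟨d :: D, by simp [hd, hD]⟩

/-! ### Ping-pong for the action on binary quadratic forms -/

/-- The action of `w` on binary quadratic forms. -/
def wMat : Matrix (Fin 3) (Fin 3) ℤ := !![0, 0, 1; 0, -1, 0; 1, 0, 0]

/-- The action of `b` on binary quadratic forms. -/
def bMat : Matrix (Fin 3) (Fin 3) ℤ := !![0, 0, 1; 0, -1, 1; 1, -2, 1]

/-- The representation of `ℤ/2 * ℤ/3` on binary quadratic forms. -/
def formRep : G23 →* Matrix (Fin 3) (Fin 3) ℤ :=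
  Monoid.Coprod.lift
    { toFun := fun i => wMat ^ (ZMod.val i.toAdd)
      map_one' := by decide
      map_mul' := by decide }
    { toFun := fun i => bMat ^ (ZMod.val i.toAdd)
      map_one' := by decide
      map_mul' := by decide }

/-- `g • v` for the action on forms. -/
def formAct (g : G23) (v : Fin 3 → ℤ) : Fin 3 → ℤ := (formRep g).mulVec v

lemma formAct_mul (g h : G23) (v : Fin 3 → ℤ) : formAct (g * h) v = formAct g (formAct h v) := by
  simp [formAct, Matrix.mulVec_mulVec]

lemma formAct_one (v : Fin 3 → ℤ) : formAct 1 v = v := by simp [formAct]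

lemma formAct_w (v : Fin 3 → ℤ) : formAct w v = ![v 2, -v 1, v 0] := by
  have : formRep w = wMat := by
    simp only [formRep, w, Monoid.Coprod.lift_apply_inl]; decide
  ext i
  fin_cases i <;> simp [formAct, this, wMat, Matrix.mulVec, dotProduct, Fin.sum_univ_three]

lemma formAct_bpow_one (v : Fin 3 → ℤ) :
    formAct (bpow 1) v = ![v 2, -v 1 + v 2, v 0 - 2 * v 1 + v 2] := by
  have : formRep (bpow 1) = bMat := by
    simp only [formRep, bpow, Monoid.Coprod.lift_apply_inr]; decide
  ext i
  fin_cases i <;> simp [formAct, this, bMat, Matrix.mulVec, dotProduct, Fin.sum_univ_three]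
  ring

lemma formAct_bpow_two (v : Fin 3 → ℤ) :
    formAct (bpow 2) v = ![v 0 - 2 * v 1 + v 2, v 0 - v 1, v 0] := by
  rw [show (2 : ZMod 3) = 1 + 1 from rfl, bpow_add, formAct_mul, formAct_bpow_one,
    formAct_bpow_one]
  ext i
  fin_cases i <;> simp <;> ring

/-- Forms with positive coefficients. -/
def PosForm (v : Fin 3 → ℤ) : Prop := 0 < v 0 ∧ 0 < v 1 ∧ 0 < v 2

/-- Forms with positive outer and negative middle coefficient. -/
def NegForm (v : Fin 3 → ℤ) : Prop := 0 < v 0 ∧ v 1 < 0 ∧ 0 < v 2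

/-- The form fixed by `b`. -/
def fixedForm : Fin 3 → ℤ := ![2, 1, 2]

/-- `g` maps `NegForm` into `PosForm`. -/
def PingPong (g : G23) : Prop := ∀ v, NegForm v → PosForm (formAct g v)

lemma PosForm.w {v : Fin 3 → ℤ} (h : PosForm v) : NegForm (formAct w v) := by
  obtain ⟨h0, h1, h2⟩ := h
  rw [formAct_w]
  exact ⟨h2, by simpa using h1, h0⟩

lemma pingPong_bpow {i : ZMod 3} (hi : i ≠ 0) : PingPong (bpow i) := by
  rintro v ⟨h0, h1, h2⟩
  have : i = 1 ∨ i = 2 := by revert i; decide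
  rcases this with rfl | rfl
  · rw [formAct_bpow_one]
    refine ⟨?_, ?_, ?_⟩ <;> simp <;> linarith
  · rw [formAct_bpow_two]
    refine ⟨?_, ?_, ?_⟩ <;> simp <;> linarith

lemma PingPong.mul_w_mul {g h : G23} (hg : PingPong g) (hh : PingPong h) :
    PingPong (g * w * h) := by
  intro v hv
  rw [formAct_mul, formAct_mul]
  exact hg _ (hh v hv).w

lemma formAct_bpow_fixedForm (i : ZMod 3) : formAct (bpow i) fixedForm = fixedForm := by
  have : i = 0 ∨ i = 1 ∨ i = 2 := by revert i; decide
  rcases this with rfl | rfl | rfl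
  · rw [bpow_zero, formAct_one]
  · rw [formAct_bpow_one]; decide
  · rw [formAct_bpow_two]; decide

lemma posForm_fixedForm : PosForm fixedForm := by
  refine ⟨?_, ?_, ?_⟩ <;> decide

lemma PosForm.not_negForm {v : Fin 3 → ℤ} (h : PosForm v) : ¬ NegForm v :=
  fun h' => lt_asymm h.2.1 h'.2.1

lemma pingPong_wordEval {l : List (ZMod 3)} {k : ZMod 3} (hl : ∀ e ∈ l, e ≠ 0) (hk : k ≠ 0) :
    PingPong (wordEval l k) := by
  induction l with
  | nil => exact pingPong_bpow hk
  | cons i l ih =>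
    exact (pingPong_bpow (hl i (by simp))).mul_w_mul (ih fun e he => hl e (by simp [he]))

lemma pingPong_wordEval_inv {l : List (ZMod 3)} {k : ZMod 3} (hl : ∀ e ∈ l, e ≠ 0) (hk : k ≠ 0) :
    PingPong (wordEval l k)⁻¹ := by
  induction l with
  | nil => rw [wordEval, bpow_inv]; exact pingPong_bpow (neg_ne_zero.2 hk)
  | cons i l ih =>
    rw [wordEval, mul_inv_rev, mul_inv_rev, bpow_inv, w_inv, ← mul_assoc]
    exact (ih fun e he => hl e (by simp [he])).mul_w_mul
      (pingPong_bpow (neg_ne_zero.2 (hl i (by simp))))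

lemma pingPong_bpow_two_mul_inv {l : List (ZMod 3)} (hl : ∀ e ∈ l, e ≠ 0) :
    PingPong (bpow 2 * (wordEval l 1)⁻¹) := by
  have : wordEval l 1 * (bpow 2)⁻¹ = wordEval l 2 := by
    clear hl
    induction l with
    | nil => rw [wordEval, wordEval, bpow_inv, ← bpow_add]; rfl
    | cons i l ih => rw [wordEval, wordEval, mul_assoc, ih]
  have h2 : bpow 2 * (wordEval l 1)⁻¹ = (wordEval l 2)⁻¹ := by rw [← this]; group
  rw [h2]
  exact pingPong_wordEval_inv hl (by decide)

/-! ### Reduced words -/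

/-- The word `(l, k)` gives a reduced expression of the conjugate `wordConj (l, k)`. -/
def Reduced (l : List (ZMod 3)) (k : ZMod 3) : Prop :=
  (l = [] ∨ k = 1) ∧ ∀ e ∈ l.tail, e ≠ 0

lemma reduced_or_exists_shorter (l : List (ZMod 3)) (k : ZMod 3) :
    Reduced l k ∨ ∃ d : BWord, d.1.length < l.length ∧ wordConj d = wordConj (l, k) := by
  induction l with
  | nil => exact .inl ⟨.inl rfl, by simp⟩
  | cons i m ih =>
    rcases ih with ⟨hk, hm⟩ | ⟨d, hd, he⟩
    · rcases m with _ | ⟨e, m⟩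
      · have : k = 1 ∨ k = 0 ∨ k = 2 := by revert k; decide
        rcases this with rfl | rfl | rfl
        · exact .inl ⟨.inr rfl, by simp⟩
        · refine .inr ⟨([], i + 2), by simp, ?_⟩
          simp only [wordConj, wordEval, bpow_add, bpow_zero, s0, ← bpow_two]
          simp only [mul_assoc, mul_inv_rev, w_inv, w_mul_w_mul, inv_one, one_mul]
          group
        · refine .inr ⟨([], i), by simp, ?_⟩
          simp only [wordConj, wordEval, s0, ← bpow_two]
          simp only [mul_assoc, mul_inv_rev, w_inv, mul_inv_cancel_left, w_mul_w_mul]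
      · obtain rfl : k = 1 := by simpa using hk
        by_cases he : e = 0
        · subst he
          refine .inr ⟨shift i (m, 1), by simp [shift_length], ?_⟩
          have : wordEval (i :: 0 :: m) 1 = bpow i * wordEval m 1 := by
            simp only [wordEval, bpow_zero, one_mul, mul_assoc, w_mul_w_mul]
          simp only [wordConj, this, wordEval_shift]
        · refine .inl ⟨.inr rfl, ?_⟩
          intro e' he'
          rcases List.mem_cons.1 he' with rfl | h
          · exact he
          · exact hm e' h
    · exact .inr ⟨(i :: d.1, d.2), by simpa using hd, by
        rw [wordConj_cons, he, ← wordConj_cons]⟩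

/-- Either there is no cancellation of a central `w` in the product of two conjugates, or the
product is `b`, or one of the conjugates can be shortened by a Hurwitz move. -/
lemma pair_cases (l : List (ZMod 3)) (k : ZMod 3) (l' : List (ZMod 3)) (k' : ZMod 3)
    (h : Reduced l k) (h' : Reduced l' k') :
    PingPong (bpow 2 * (wordEval l k)⁻¹ * wordEval l' k') ∨
    (l = l' ∧ k' = k + 1) ∨
    (∃ d : BWord, d.1.length < l'.length ∧
      wordConj d = wordConj (l, k) * wordConj (l', k') * (wordConj (l, k))⁻¹) ∨
    (∃ d : BWord, d.1.length < l.length ∧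
      wordConj d = (wordConj (l', k'))⁻¹ * wordConj (l, k) * wordConj (l', k')) := by
  induction l generalizing l' with
  | nil =>
    rcases l' with _ | ⟨j, m⟩
    · by_cases hk : k' = k + 1
      · exact .inr (.inl ⟨rfl, hk⟩)
      · left
        simp only [wordEval, bpow_inv, ← bpow_add]
        apply pingPong_bpow
        clear h h'
        revert k k'; decide
    · obtain rfl : k' = 1 := by simpa using h'.1
      by_cases hj : j = k + 1
      · right; right; left
        refine ⟨shift k (m, 1), by simp [shift_length], ?_⟩
        apply wordConj_of_mul_left (d := (j :: m, 1))
        rw [wordEval_shift, wordConj_nil, hj]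
        simp only [wordEval, mul_assoc, bpow_mul_bpow_mul]
        rw [show 2 - k + (k + 1) = 0 by clear h hj; revert k; decide, bpow_zero, one_mul,
          w_mul_w_mul]
      · left
        simp only [wordEval, bpow_inv, ← bpow_add, ← mul_assoc]
        refine (pingPong_bpow ?_).mul_w_mul (pingPong_wordEval h'.2 (by decide))
        clear h h'
        revert k j; decide
  | cons i m ih =>
    obtain rfl : k = 1 := by simpa using h.1
    rcases l' with _ | ⟨j, m'⟩
    · by_cases hk : k' = i
      · right; right; right
        refine ⟨shift (i + 1) (m, 1), by simp [shift_length], ?_⟩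
        have := wordConj_of_mul_left (d := (i :: m, 1)) (d' := shift (i + 1) (m, 1))
          (h := (wordConj ([], k'))⁻¹) ?_
        · rw [this, inv_inv]
        · rw [wordEval_shift, wordConj_nil_inv, hk]
          simp only [wordEval, mul_assoc, bpow_mul_bpow_mul]
          rw [neg_add_cancel, bpow_zero, one_mul, w_mul_w_mul, add_comm]
      · left
        have : bpow 2 * (wordEval (i :: m) 1)⁻¹ * wordEval [] k' =
            bpow 2 * (wordEval m 1)⁻¹ * w * bpow (-i + k') := by
          simp only [wordEval, mul_inv_rev, w_inv, bpow_inv, mul_assoc, bpow_add]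
        rw [this]
        refine (pingPong_bpow_two_mul_inv h.2).mul_w_mul (pingPong_bpow ?_)
        rwa [neg_add_eq_sub, sub_ne_zero]
    · obtain rfl : k' = 1 := by simpa using h'.1
      by_cases hj : j = i
      · subst hj
        have hz : bpow 2 * (wordEval (j :: m) 1)⁻¹ * wordEval (j :: m') 1 =
            bpow 2 * (wordEval m 1)⁻¹ * wordEval m' 1 := by
          simp only [wordEval]; group
        rw [hz]
        have c (n : List (ZMod 3)) := wordConj_cons j (n, 1)
        rcases ih m' ⟨.inr rfl, fun e he => h.2 e (List.mem_of_mem_tail he)⟩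
          ⟨.inr rfl, fun e he => h'.2 e (List.mem_of_mem_tail he)⟩ with
          h1 | h1 | ⟨d, hd, he⟩ | ⟨d, hd, he⟩
        · exact .inl h1
        · exact absurd h1.2 (by decide)
        · refine .inr (.inr (.inl ⟨(j :: d.1, d.2), by simpa using hd, ?_⟩))
          rw [wordConj_cons, he, c, c]; group
        · refine .inr (.inr (.inr ⟨(j :: d.1, d.2), by simpa using hd, ?_⟩))
          rw [wordConj_cons, he, c, c]; group
      · left
        have : bpow 2 * (wordEval (i :: m) 1)⁻¹ * wordEval (j :: m') 1 =
            bpow 2 * (wordEval m 1)⁻¹ * w * bpow (-i + j) * w * wordEval m' 1 := by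
          simp only [wordEval, mul_inv_rev, w_inv, bpow_inv, mul_assoc, bpow_add]
        rw [this]
        refine ((pingPong_bpow_two_mul_inv h.2).mul_w_mul (pingPong_bpow ?_)).mul_w_mul
          (pingPong_wordEval h'.2 (by decide))
        rwa [neg_add_eq_sub, sub_ne_zero]

lemma posForm_wordEval_inv {l : List (ZMod 3)} {k : ZMod 3} (h : Reduced l k) :
    PosForm (formAct (wordEval l k)⁻¹ fixedForm) ∧
    PosForm (formAct (bpow 2 * (wordEval l k)⁻¹) fixedForm) := by
  rcases l with _ | ⟨i, m⟩
  · rw [wordEval, bpow_inv, ← bpow_add, formAct_bpow_fixedForm, formAct_bpow_fixedForm]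
    exact ⟨posForm_fixedForm, posForm_fixedForm⟩
  · obtain rfl : k = 1 := by simpa using h.1
    have hn : NegForm (formAct (w * bpow (-i)) fixedForm) := by
      rw [formAct_mul, formAct_bpow_fixedForm]
      exact posForm_fixedForm.w
    have key {g : G23} (hg : PingPong g) :
        PosForm (formAct (g * (w * bpow (-i))) fixedForm) := by
      rw [formAct_mul]; exact hg _ hn
    have e : (wordEval (i :: m) 1)⁻¹ = (wordEval m 1)⁻¹ * (w * bpow (-i)) := by
      simp only [wordEval, mul_inv_rev, w_inv, bpow_inv]
    rw [e, ← mul_assoc (bpow 2)]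
    exact ⟨key (pingPong_wordEval_inv h.2 (by decide)), key (pingPong_bpow_two_mul_inv h.2)⟩

/-- No cancellation of a central `w` occurs in the product of the conjugates given by two words. -/
def NoCancel (d d' : BWord) : Prop :=
  PingPong (bpow 2 * (wordEval d.1 d.2)⁻¹ * wordEval d'.1 d'.2)

lemma negForm_of_isChain {d : BWord} {D : List BWord} (hr : ∀ x ∈ d :: D, Reduced x.1 x.2)
    (hc : (d :: D).IsChain NoCancel) :
    NegForm (formAct ((wordEval d.1 d.2)⁻¹ * ((d :: D).map wordConj).prod) fixedForm) := by
  induction D generalizing d with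
  | nil =>
    have e : (wordEval d.1 d.2)⁻¹ * ([d].map wordConj).prod =
        w * (bpow 2 * (wordEval d.1 d.2)⁻¹) := by
      simp only [List.map_cons, List.map_nil, List.prod_singleton, wordConj, s0, bpow_two]; group
    rw [e, formAct_mul]
    exact (posForm_wordEval_inv (hr d (by simp))).2.w
  | cons d' D ih =>
    rw [List.isChain_cons_cons] at hc
    have e : (wordEval d.1 d.2)⁻¹ * ((d :: d' :: D).map wordConj).prod =
        w * ((bpow 2 * (wordEval d.1 d.2)⁻¹ * wordEval d'.1 d'.2) *
          ((wordEval d'.1 d'.2)⁻¹ * ((d' :: D).map wordConj).prod)) := by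
      rw [List.map_cons, List.prod_cons, wordConj, s0, bpow_two]; group
    rw [e, formAct_mul, formAct_mul]
    exact (hc.1 _ (ih (fun x hx => hr x (List.mem_cons_of_mem _ hx)) hc.2)).w

lemma eq_nil_of_isChain {D : List BWord} (hr : ∀ x ∈ D, Reduced x.1 x.2)
    (hc : D.IsChain NoCancel)
    (hD : formAct (D.map wordConj).prod fixedForm = fixedForm) : D = [] := by
  rcases D with _ | ⟨d, D⟩
  · rfl
  · have h := negForm_of_isChain hr hc
    rw [formAct_mul, hD] at h
    exact absurd h (posForm_wordEval_inv (hr d (by simp))).1.not_negForm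

/-! ### Hurwitz equivalence -/

section Hurwitz

variable {G : Type*} [Group G]

lemma HurwitzMove.prod_eq {L L' : List G} (h : HurwitzMove L L') : L'.prod = L.prod := by
  obtain ⟨p, x, y, t, rfl, rfl | rfl⟩ := h <;> simp [mul_assoc]

lemma HurwitzMove.length_eq {L L' : List G} (h : HurwitzMove L L') : L'.length = L.length := by
  obtain ⟨p, x, y, t, rfl, rfl | rfl⟩ := h <;> simp

lemma HurwitzMove.append_left {L L' : List G} (h : HurwitzMove L L') (q : List G) :
    HurwitzMove (q ++ L) (q ++ L') := by
  obtain ⟨p, x, y, t, rfl, rfl | rfl⟩ := h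
  · exact ⟨q ++ p, x, y, t, by simp, .inl (by simp)⟩
  · exact ⟨q ++ p, x, y, t, by simp, .inr (by simp)⟩

lemma HurwitzEquiv.prod_eq {L L' : List G} (h : HurwitzEquiv L L') : L'.prod = L.prod := by
  induction h with
  | refl => rfl
  | tail _ h ih => rw [h.prod_eq, ih]

lemma HurwitzEquiv.length_eq {L L' : List G} (h : HurwitzEquiv L L') :
    L'.length = L.length := by
  induction h with
  | refl => rfl
  | tail _ h ih => rw [h.length_eq, ih]

lemma HurwitzEquiv.trans {L₁ L₂ L₃ : List G} (h : HurwitzEquiv L₁ L₂) (h' : HurwitzEquiv L₂ L₃) :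
    HurwitzEquiv L₁ L₃ :=
  Relation.ReflTransGen.trans h h'

lemma HurwitzEquiv.append_left {L L' : List G} (h : HurwitzEquiv L L') (q : List G) :
    HurwitzEquiv (q ++ L) (q ++ L') :=
  Relation.ReflTransGen.lift (q ++ ·) (fun _ _ h => HurwitzMove.append_left h q) _ _ h

lemma hurwitzMove_right (p : List G) (x y : G) (t : List G) :
    HurwitzMove (p ++ x :: y :: t) (p ++ y :: (y⁻¹ * x * y) :: t) :=
  ⟨p, x, y, t, rfl, .inl rfl⟩

lemma hurwitzMove_left (p : List G) (x y : G) (t : List G) :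
    HurwitzMove (p ++ x :: y :: t) (p ++ (x * y * x⁻¹) :: x :: t) :=
  ⟨p, x, y, t, rfl, .inr rfl⟩

/-- A pair of entries can be moved to the front, conjugating what it passes by its product. -/
lemma hurwitzEquiv_pair_to_front (A : List G) (x y : G) (B : List G) :
    HurwitzEquiv (A ++ x :: y :: B)
      (x :: y :: (A.map (fun a => (x * y)⁻¹ * a * (x * y)) ++ B)) := by
  induction A with
  | nil => exact .refl
  | cons a A ih =>
    refine (ih.append_left [a]).trans ?_
    refine .head (hurwitzMove_right [] a x _) (.head (hurwitzMove_right [x] _ y _) ?_)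
    rw [show y⁻¹ * (x⁻¹ * a * x) * y = (x * y)⁻¹ * a * (x * y) by group]
    exact .refl

end Hurwitz

lemma hurwitzEquiv_s0_s1 (k : ZMod 3) (B : List G23) :
    HurwitzEquiv (wordConj ([], k) :: wordConj ([], k + 1) :: B) (s0 :: s1 :: B) := by
  have step (k : ZMod 3) : HurwitzEquiv (wordConj ([], k) :: wordConj ([], k + 1) :: B)
      (wordConj ([], k + 1) :: wordConj ([], k + 1 + 1) :: B) := by
    have e : (wordConj ([], k + 1))⁻¹ * wordConj ([], k) * wordConj ([], k + 1) =
        wordConj ([], k + 1 + 1) := by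
      rw [mul_assoc, wordConj_nil_mul_succ, inv_mul_eq_iff_eq_mul, wordConj_nil_mul_succ]
    rw [← e]
    exact .single (hurwitzMove_right [] _ _ B)
  have h0 : HurwitzEquiv (wordConj ([], 0) :: wordConj ([], 0 + 1) :: B) (s0 :: s1 :: B) := by
    rw [zero_add, wordConj_nil_zero, wordConj_nil_one]; exact .refl
  have h2 := (step 2).trans h0
  have : k = 0 ∨ k = 1 ∨ k = 2 := by revert k; decide
  rcases this with rfl | rfl | rfl
  · exact h0
  · exact (step 1).trans h2
  · exact h2

/-- The total size of a list of words. -/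
def totalSize (D : List BWord) : ℕ := (D.map fun d => d.1.length + 1).sum

/-- A sequence of conjugates of `s₀` whose product fixes the same form as `b` is Hurwitz
equivalent to a sequence `s₀, s₁, s₀, s₁, …, s₀, s₁`. -/
lemma exists_hurwitzEquiv_flatten (D : List BWord)
    (hD : formAct (D.map wordConj).prod fixedForm = fixedForm) :
    ∃ n, HurwitzEquiv (D.map wordConj) (List.replicate n [s0, s1]).flatten := by
  induction hN : totalSize D using Nat.strong_induction_on generalizing D with
  | _ N ih =>
  subst hN
  have of_move (D' : List BWord) (hlt : totalSize D' < totalSize D)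
      (hm : HurwitzEquiv (D.map wordConj) (D'.map wordConj)) :
      ∃ n, HurwitzEquiv (D.map wordConj) (List.replicate n [s0, s1]).flatten := by
    obtain ⟨n, hn⟩ := ih _ hlt D' (by rw [hm.prod_eq, hD]) rfl
    exact ⟨n, hm.trans hn⟩
  by_cases hr : ∀ x ∈ D, Reduced x.1 x.2
  swap
  · push Not at hr
    obtain ⟨x, hx, hxr⟩ := hr
    obtain ⟨d, hd, he⟩ := (reduced_or_exists_shorter x.1 x.2).resolve_left hxr
    obtain ⟨A, B, rfl⟩ := List.append_of_mem hx
    refine of_move (A ++ d :: B) (by simp [totalSize]; omega) ?_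
    simp only [List.map_append, List.map_cons, he]
    exact .refl
  by_cases hc : D.IsChain NoCancel
  · exact ⟨0, by rw [eq_nil_of_isChain hr hc hD]; exact .refl⟩
  rw [List.isChain_iff_forall_rel_of_append_cons_cons] at hc
  push Not at hc
  obtain ⟨⟨l, k⟩, ⟨l', k'⟩, A, B, rfl, hxy⟩ := hc
  have hl := hr (l, k) (by simp)
  have hl' := hr (l', k') (by simp)
  rcases pair_cases l k l' k' hl hl' with h | ⟨rfl, rfl⟩ | ⟨d, hd, he⟩ | ⟨d, hd, he⟩
  · exact absurd h hxy
  · have hnil : l = [] := by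
      rcases hl.1 with h | rfl
      · exact h
      · exact hl'.1.resolve_right (show (1 : ZMod 3) + 1 ≠ 1 by decide)
    subst hnil
    set D' := A.map (shift (-1)) ++ B with hD'
    have hmap : D'.map wordConj =
        (A.map wordConj).map (fun a => b⁻¹ * a * b) ++ B.map wordConj := by
      simp only [hD', List.map_append, List.map_map]
      congr 2
      ext d
      simp only [Function.comp, wordConj_shift, ← bpow_one, bpow_inv, neg_neg]
    have hsize : totalSize D' < totalSize (A ++ ([], k) :: ([], k + 1) :: B) := by
      simp [totalSize, hD', Function.comp_def, shift_length]
      omega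
    have hm : HurwitzEquiv ((A ++ ([], k) :: ([], k + 1) :: B).map wordConj)
        (s0 :: s1 :: D'.map wordConj) := by
      have := hurwitzEquiv_pair_to_front (A.map wordConj) (wordConj ([], k))
        (wordConj ([], k + 1)) (B.map wordConj)
      rw [wordConj_nil_mul_succ, ← hmap] at this
      simpa using this.trans (hurwitzEquiv_s0_s1 k _)
    have hfix : formAct (D'.map wordConj).prod fixedForm = fixedForm := by
      have hp := hm.prod_eq
      rw [List.prod_cons, List.prod_cons, ← mul_assoc, s0_mul_s1, ← bpow_one,
        ← eq_inv_mul_iff_mul_eq, bpow_inv] at hp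
      rw [hp, formAct_mul, hD, formAct_bpow_fixedForm]
    obtain ⟨n, hn⟩ := ih _ hsize D' hfix rfl
    refine ⟨n + 1, hm.trans ?_⟩
    rw [List.replicate_succ, List.flatten_cons]
    exact hn.append_left [s0, s1]
  · refine of_move (A ++ d :: (l, k) :: B) (by simp [totalSize]; omega) ?_
    simp only [List.map_append, List.map_cons, he]
    exact .single (hurwitzMove_left _ _ _ _)
  · refine of_move (A ++ (l', k') :: d :: B) (by simp [totalSize]; omega) ?_
    simp only [List.map_append, List.map_cons, he]
    exact .single (hurwitzMove_right _ _ _ _)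

lemma prod_flatten_replicate (n : ℕ) :
    ((List.replicate n [s0, s1]).flatten).prod = bpow n := by
  induction n with
  | zero => simp [bpow_zero]
  | succ n ih =>
    rw [List.replicate_succ, List.flatten_cons, List.prod_append, ih, List.prod_cons,
      List.prod_singleton, s0_mul_s1, ← bpow_one, ← bpow_add, Nat.cast_succ, add_comm]

lemma isConj_s1_s0 : IsConj s1 s0 := by
  rw [isConj_iff]
  refine ⟨b⁻¹, ?_⟩
  simp only [s0, s1, pow_two]; group

/-- **`PSL(2,ℤ)` normal factorization, Kodaira type IV.**  If `(s₀s₁)² = g₁⋯g_r` with each `gᵢ` a conjugate of `s₁`, then `r ≥ 4` and Hurwitz moves transform `(g₁,…,g_r)` into a sequence of conjugates of `s₁` beginning `s₀, s₁, s₀, s₁` with the remaining terms multiplying to `1`. -/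
theorem psl_normal_factorization_IV (L : List G23)
    (hconj : ∀ g ∈ L, IsConj s1 g)
    (hprod : L.prod = (s0 * s1) ^ 2) :
    4 ≤ L.length ∧
    ∃ L' : List G23, HurwitzEquiv L L' ∧ (∀ g ∈ L', IsConj s1 g) ∧
      L'.take 4 = [s0, s1, s0, s1] ∧ (L'.drop 4).prod = 1 := by
  obtain ⟨D, rfl⟩ := exists_map_wordConj hconj
  have hprod' : (D.map wordConj).prod = bpow 2 := by
    rw [hprod, s0_mul_s1, bpow_two]
  obtain ⟨n, hn⟩ := exists_hurwitzEquiv_flatten D (by rw [hprod', formAct_bpow_fixedForm])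
  have hbn : (n : ZMod 3) = 2 := by
    have h := hn.prod_eq
    rw [hprod', prod_flatten_replicate] at h
    exact Multiplicative.ofAdd.injective (Monoid.Coprod.inr_injective h)
  obtain ⟨m, rfl⟩ : ∃ m, n = m + 2 := by
    rcases n with _ | _ | m
    · exact absurd hbn (by decide)
    · exact absurd hbn (by decide)
    · exact ⟨m, rfl⟩
  have hlen := hn.length_eq
  refine ⟨by rw [← hlen]; simp; omega, _, hn, ?_, ?_, ?_⟩
  · intro g hg
    obtain ⟨l, hl, hgl⟩ := List.mem_flatten.1 hg
    obtain rfl := List.eq_of_mem_replicate hl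
    rcases List.mem_pair.1 hgl with rfl | rfl
    · exact isConj_s1_s0
    · exact IsConj.refl _
  · simp [List.replicate_succ]
  · have hm : (m : ZMod 3) = 0 := by simpa using hbn
    have : ((List.replicate (m + 2) [s0, s1]).flatten).drop 4 =
        (List.replicate m [s0, s1]).flatten := by
      simp [List.replicate_succ]
    rw [this, prod_flatten_replicate, hm, bpow_zero]
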